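/- arXiv:2102.04742 — 2 statements merged into one kernel-verified Lean document; each statement's English description precedes it below -/
import Mathlib

section
/- Let (g,[-,-],{-,-}) be a compatible Lie algebra over a field K of characteristic 0 and let (V; ρ, μ) be a representation of g. Let d1^n denote the Chevalley–Eilenberg coboundary operator of the Lie algebra (g,[-,-]) with coefficients in (V;ρ), and d2^n that of (g,{-,-}) with coefficients in (V;μ), acting on alternating n-linear maps from g to V. Then for every n ≥ 0: d1^{n+1} ∘ d1^n = 0, d2^{n+1} ∘ d2^n = 0, and d1^{n+1} ∘ d2^n + d2^{n+1} ∘ d1^n = 0. -/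
def IsBilin (K : Type*) {A B C : Type*} [Field K]
    [AddCommGroup A] [Module K A] [AddCommGroup B] [Module K B]
    [AddCommGroup C] [Module K C] (f : A → B → C) : Prop :=
  (∀ a a' b, f (a + a') b = f a b + f a' b) ∧
  (∀ (c : K) (a b), f (c • a) b = c • f a b) ∧
  (∀ a b b', f a (b + b') = f a b + f a b') ∧
  (∀ (c : K) (a b), f a (c • b) = c • f a b)

/-- A Lie bracket: a bilinear, alternating map satisfying the Jacobi identity. -/
def IsLieBr (K : Type*) {g : Type*} [Field K] [AddCommGroup g] [Module K g]
    (br : g → g → g) : Prop :=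
  IsBilin K br ∧ (∀ x, br x x = 0) ∧
  (∀ x y z, br (br x y) z + br (br y z) x + br (br z x) y = 0)

/-- The compatibility condition between two brackets. -/
def IsCompatPair {g : Type*} [AddCommGroup g] (br1 br2 : g → g → g) : Prop :=
  ∀ x y z : g, br1 (br2 x y) z + br1 (br2 y z) x + br1 (br2 z x) y +
    br2 (br1 x y) z + br2 (br1 y z) x + br2 (br1 z x) y = 0

/-- A compatible Lie algebra structure: two Lie brackets satisfying the
compatibility condition. -/
def IsCompatLie (K : Type*) {g : Type*} [Field K] [AddCommGroup g] [Module K g]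
    (br1 br2 : g → g → g) : Prop :=
  IsLieBr K br1 ∧ IsLieBr K br2 ∧ IsCompatPair br1 br2
/-- A representation of the Lie algebra `(g, br)` on `V`. -/
def IsRep (K : Type*) {g V : Type*} [Field K] [AddCommGroup g] [Module K g]
    [AddCommGroup V] [Module K V] (br : g → g → g) (ρ : g → V → V) : Prop :=
  (∀ x, IsLinearMap K (ρ x)) ∧
  (∀ x y v, ρ (x + y) v = ρ x v + ρ y v) ∧
  (∀ (c : K) (x : g) (v : V), ρ (c • x) v = c • ρ x v) ∧
  (∀ x y v, ρ (br x y) v = ρ x (ρ y v) - ρ y (ρ x v))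

/-- A representation of the compatible Lie algebra `(g, br1, br2)` on `V`. -/
def IsCompatRep (K : Type*) {g V : Type*} [Field K] [AddCommGroup g] [Module K g]
    [AddCommGroup V] [Module K V] (br1 br2 : g → g → g) (ρ μ : g → V → V) : Prop :=
  IsRep K br1 ρ ∧ IsRep K br2 μ ∧
  ∀ x y v, ρ (br2 x y) v + μ (br1 x y) v =
    ρ x (μ y v) - μ y (ρ x v) + μ x (ρ y v) - ρ y (μ x v)
/-- The Chevalley–Eilenberg coboundary operator of the Lie algebra `(g, br)` with
coefficients in the representation `ρ` on `V`, acting on `n`-cochains: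
`(d f)(x₁,…,x_{n+1}) = Σᵢ (-1)^{i+1} ρ(xᵢ) f(x₁,…,x̂ᵢ,…,x_{n+1})
  + Σ_{i<j} (-1)^{i+j} f(br(xᵢ,xⱼ), x₁,…,x̂ᵢ,…,x̂ⱼ,…,x_{n+1})` (here written 0-indexed). -/
def ceD {g V : Type*} [AddCommGroup V] (br : g → g → g) (ρ : g → V → V) :
    (n : ℕ) → ((Fin n → g) → V) → ((Fin (n + 1) → g) → V)
  | 0, f => fun x => ρ (x 0) (f Fin.elim0)
  | (m + 1), f => fun x =>
      (∑ i : Fin (m + 2), (-1 : ℤ) ^ (i : ℕ) • ρ (x i) (f (fun k => x (i.succAbove k)))) +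
      ∑ i : Fin (m + 2), ∑ j : Fin (m + 2),
        if h : (i : ℕ) < (j : ℕ) then
          (-1 : ℤ) ^ ((i : ℕ) + (j : ℕ)) •
            f (Fin.cons (br (x i) (x j))
                (fun k : Fin m =>
                  x (j.succAbove
                      ((⟨(i : ℕ), lt_of_lt_of_le h (Nat.lt_succ_iff.mp j.isLt)⟩ :
                        Fin (m + 1)).succAbove k))))
        else 0

/-- Insertion of `x` in the first slot of a cochain. -/
def insertFirst {g V : Type*} (x : g) {n : ℕ} (f : (Fin (n + 1) → g) → V) :
    (Fin n → g) → V :=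
  fun y => f (Fin.cons x y)

theorem insertFirst_ext {g V : Type*} {n : ℕ} {f f' : (Fin (n + 1) → g) → V}
    (h : ∀ x, insertFirst x f = insertFirst x f') : f = f' := by
  funext y
  have := congrFun (h (y 0)) (Fin.tail y)
  simpa [insertFirst] using this

section Additive

variable {g V : Type*} [AddCommGroup V] {n : ℕ}

theorem insertFirst_add (x : g) (f f' : (Fin (n + 1) → g) → V) :
    insertFirst x (f + f') = insertFirst x f + insertFirst x f' := rfl

theorem insertFirst_sub (x : g) (f f' : (Fin (n + 1) → g) → V) :
    insertFirst x (f - f') = insertFirst x f - insertFirst x f' := rfl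

theorem insertFirst_neg (x : g) (f : (Fin (n + 1) → g) → V) :
    insertFirst x (-f) = -insertFirst x f := rfl

end Additive

/-- Skew-symmetry of a cochain in its first two arguments (no condition in degree one). -/
def IsSkewFirst {g V : Type*} [AddCommGroup V] :
    (n : ℕ) → ((Fin (n + 1) → g) → V) → Prop
  | 0, _ => True
  | _ + 1, f => ∀ x y, insertFirst y (insertFirst x f) = -insertFirst x (insertFirst y f)

section IsSkewFirst

variable {g V : Type*} [AddCommGroup V]

theorem IsSkewFirst.add {n : ℕ} {f f' : (Fin (n + 1) → g) → V}
    (h : IsSkewFirst n f) (h' : IsSkewFirst n f') : IsSkewFirst n (f + f') := by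
  cases n with
  | zero => trivial
  | succ n => intro x y; simp only [insertFirst_add, h x y, h' x y]; abel

theorem IsSkewFirst.neg {n : ℕ} {f : (Fin (n + 1) → g) → V}
    (h : IsSkewFirst n f) : IsSkewFirst n (-f) := by
  cases n with
  | zero => trivial
  | succ n => intro x y; simp only [insertFirst_neg, h x y]

end IsSkewFirst

/-- Additive skew-symmetric cochains, described recursively through `insertFirst`. -/
def IsCochain {g V : Type*} [AddCommGroup g] [AddCommGroup V] :
    (n : ℕ) → ((Fin n → g) → V) → Prop
  | 0, _ => True
  | n + 1, f => (∀ x y, insertFirst (x + y) f = insertFirst x f + insertFirst y f) ∧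
      (∀ x, IsCochain n (insertFirst x f)) ∧ IsSkewFirst n f

section IsCochain

variable {g V : Type*} [AddCommGroup g] [AddCommGroup V]

theorem IsCochain.add {n : ℕ} {f f' : (Fin n → g) → V}
    (h : IsCochain n f) (h' : IsCochain n f') : IsCochain n (f + f') := by
  induction n with
  | zero => trivial
  | succ n ih =>
    refine ⟨fun x y => ?_, fun x => ih (h.2.1 x) (h'.2.1 x), h.2.2.add h'.2.2⟩
    simp only [insertFirst_add, h.1, h'.1]; abel

theorem IsCochain.neg {n : ℕ} {f : (Fin n → g) → V}
    (h : IsCochain n f) : IsCochain n (-f) := by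
  induction n with
  | zero => trivial
  | succ n ih =>
    refine ⟨fun x y => ?_, fun x => ih (h.2.1 x), h.2.2.neg⟩
    simp only [insertFirst_neg, h.1]; abel

theorem IsCochain.sub {n : ℕ} {f f' : (Fin n → g) → V}
    (h : IsCochain n f) (h' : IsCochain n f') : IsCochain n (f - f') := by
  rw [sub_eq_add_neg]; exact h.add h'.neg

theorem IsCochain.cons_add {n : ℕ} {f : (Fin (n + 1) → g) → V} (h : IsCochain (n + 1) f)
    (x y : g) (z : Fin n → g) :
    f (Fin.cons (x + y) z) = f (Fin.cons x z) + f (Fin.cons y z) :=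
  congrFun (h.1 x y) z

theorem IsCochain.cons_swap {n : ℕ} {f : (Fin (n + 2) → g) → V} (h : IsCochain (n + 2) f)
    (x y : g) (z : Fin n → g) :
    f (Fin.cons x (Fin.cons y z)) = -f (Fin.cons y (Fin.cons x z)) :=
  congrFun (h.2.2 x y) z

theorem IsCochain.insertFirst_neg_arg {n : ℕ} {f : (Fin (n + 1) → g) → V}
    (h : IsCochain (n + 1) f) (x : g) : insertFirst (-x) f = -insertFirst x f := by
  have h0 : insertFirst (0 : g) f = 0 := by simpa using h.1 0 0
  have := h.1 (-x) x
  rw [neg_add_cancel, h0] at this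
  exact eq_neg_of_add_eq_zero_left this.symm

end IsCochain

theorem AlternatingMap.isCochain {K g V : Type*} [Field K] [AddCommGroup g] [Module K g]
    [AddCommGroup V] [Module K V] {n : ℕ} (f : AlternatingMap K g V (Fin n)) :
    IsCochain n ⇑f := by
  induction n with
  | zero => trivial
  | succ n ih =>
    refine ⟨fun x y => ?_, fun x => ih (f.curryLeft x), ?_⟩
    · funext z
      exact f.toMultilinearMap.cons_add z x y
    · cases n with
      | zero => trivial
      | succ n =>
        intro x y
        funext z
        have := f.map_swap (Fin.cons y (Fin.cons x z)) (i := 0) (j := 1) (by simp)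
        rw [Pi.neg_apply]
        change f (Fin.cons x (Fin.cons y z)) = -f (Fin.cons y (Fin.cons x z))
        rw [← this]
        congr 1
        funext k
        refine Fin.cases ?_ (fun k => ?_) k
        · simp
        · refine Fin.cases ?_ (fun k => ?_) k
          · simp
          · rw [Function.comp_apply, Equiv.swap_apply_of_ne_of_ne]
            · simp
            · exact Fin.succ_ne_zero _
            · simp [Fin.ext_iff]

/-- The Lie derivative of cochains along `x`. -/
def lieD {g V : Type*} [AddCommGroup V] (br : g → g → g) (ρ : g → V → V) (x : g) :
    (n : ℕ) → ((Fin n → g) → V) → ((Fin n → g) → V)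
  | 0, f => fun y => ρ x (f y)
  | n + 1, f => fun y => ρ x (f y) -
      ∑ j : Fin (n + 1), (-1 : ℤ) ^ (j : ℕ) • f (Fin.cons (br x (y j)) (fun k => y (j.succAbove k)))

theorem insertFirst_ceD_zero {g V : Type*} [AddCommGroup V] {br : g → g → g} {ρ : g → V → V}
    (f : (Fin 0 → g) → V) (x : g) :
    insertFirst x (ceD br ρ 0 f) = lieD br ρ x 0 f := by
  funext z
  simp only [insertFirst, ceD, lieD, Fin.cons_zero]
  rw [Subsingleton.elim z Fin.elim0]

section Cartan

variable {K g V : Type*} [Field K] [AddCommGroup g] [Module K g] [AddCommGroup V] [Module K V]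
  {br : g → g → g} {ρ : g → V → V}

theorem IsLieBr.skew (hb : IsLieBr K br) (x y : g) : br x y = -br y x := by
  have h := hb.2.1 (x + y)
  rw [hb.1.1, hb.1.2.2.1, hb.1.2.2.1, hb.2.1, hb.2.1, zero_add, add_zero] at h
  exact eq_neg_of_add_eq_zero_left h

theorem IsLieBr.leibniz (hb : IsLieBr K br) (x y z : g) :
    br x (br y z) = br (br x y) z + br y (br x z) := by
  have hneg (a b : g) : br (-a) b = -br a b := by
    simpa using hb.1.2.1 (-1) a b
  have h := hb.2.2 x y z
  rw [hb.skew (br y z) x, hb.skew (br z x) y, hb.skew z x, hb.skew y (-br x z), hneg,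
    neg_neg, hb.skew (br x z) y] at h
  rw [← sub_eq_zero, ← neg_eq_zero, ← h]
  abel

theorem lieD_add (hr : IsRep K br ρ) (x : g) {n : ℕ} (f f' : (Fin n → g) → V) :
    lieD br ρ x n (f + f') = lieD br ρ x n f + lieD br ρ x n f' := by
  funext y
  cases n with
  | zero => exact (hr.1 x).map_add _ _
  | succ n =>
    simp only [lieD, Pi.add_apply, (hr.1 x).map_add, smul_add, Finset.sum_add_distrib]
    abel

theorem ceD_add (hr : IsRep K br ρ) {n : ℕ} (f f' : (Fin n → g) → V) :
    ceD br ρ n (f + f') = ceD br ρ n f + ceD br ρ n f' := by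
  funext y
  cases n with
  | zero => exact (hr.1 _).map_add _ _
  | succ n =>
    simp only [ceD, Pi.add_apply, (hr.1 _).map_add, smul_add, Finset.sum_add_distrib]
    rw [add_add_add_comm]
    congr 1
    simp only [← Finset.sum_add_distrib]
    refine Finset.sum_congr rfl fun i _ => Finset.sum_congr rfl fun j _ => ?_
    split_ifs <;> simp

theorem lieD_sub (hr : IsRep K br ρ) (x : g) {n : ℕ} (f f' : (Fin n → g) → V) :
    lieD br ρ x n (f - f') = lieD br ρ x n f - lieD br ρ x n f' := by
  rw [eq_sub_iff_add_eq, ← lieD_add hr, sub_add_cancel]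

theorem ceD_sub (hr : IsRep K br ρ) {n : ℕ} (f f' : (Fin n → g) → V) :
    ceD br ρ n (f - f') = ceD br ρ n f - ceD br ρ n f' := by
  rw [eq_sub_iff_add_eq, ← ceD_add hr, sub_add_cancel]

theorem lieD_neg (hr : IsRep K br ρ) (x : g) {n : ℕ} (f : (Fin n → g) → V) :
    lieD br ρ x n (-f) = -lieD br ρ x n f := by
  have h := lieD_sub hr x f f
  have h' := lieD_sub hr x (f - f) f
  rwa [h, sub_self, sub_self, zero_sub, zero_sub] at h'

theorem ceD_neg (hr : IsRep K br ρ) {n : ℕ} (f : (Fin n → g) → V) :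
    ceD br ρ n (-f) = -ceD br ρ n f := by
  have h := ceD_sub hr f f
  have h' := ceD_sub hr (f - f) f
  rwa [h, sub_self, sub_self, zero_sub, zero_sub] at h'

theorem lieD_add_arg (hb : IsLieBr K br) (hr : IsRep K br ρ) {n : ℕ} {f : (Fin n → g) → V}
    (hf : IsCochain n f) (x y : g) :
    lieD br ρ (x + y) n f = lieD br ρ x n f + lieD br ρ y n f := by
  funext z
  cases n with
  | zero => exact hr.2.1 _ _ _
  | succ n =>
    simp only [lieD, Pi.add_apply, hr.2.1, hb.1.1, hf.cons_add, smul_add,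
      Finset.sum_add_distrib]
    abel

theorem insertFirst_lieD {n : ℕ} {f : (Fin (n + 1) → g) → V}
    (hf : IsCochain (n + 1) f) (x y : g) :
    insertFirst y (lieD br ρ x (n + 1) f) =
      lieD br ρ x n (insertFirst y f) - insertFirst (br x y) f := by
  funext z
  cases n with
  | zero => simp [insertFirst, lieD]
  | succ n =>
    have h (j : Fin (n + 1)) :
        (fun k => (Fin.cons y z : Fin (n + 2) → g) (j.succ.succAbove k)) =
          Fin.cons y (fun k => z (j.succAbove k)) := by
      funext k
      refine Fin.cases ?_ (fun k => ?_) k <;> simp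
    simp only [insertFirst, lieD, Pi.sub_apply, Fin.sum_univ_succ (n := n + 1), Fin.cons_zero,
      Fin.cons_succ, h, hf.cons_swap _ y, Fin.val_succ, pow_succ, Fin.val_zero, pow_zero,
      one_smul, Fin.zero_succAbove, mul_neg, mul_one, neg_smul, smul_neg, neg_neg]
    abel

theorem insertFirst_ceD {n : ℕ} {f : (Fin (n + 1) → g) → V}
    (hf : IsCochain (n + 1) f) (x : g) :
    insertFirst x (ceD br ρ (n + 1) f) =
      lieD br ρ x (n + 1) f - ceD br ρ n (insertFirst x f) := by
  funext z
  cases n with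
  | zero =>
    have h : (fun k => (Fin.cons x z : Fin 2 → g) (Fin.succAbove 1 k)) =
        Fin.cons x Fin.elim0 := by
      funext k
      fin_cases k
      rfl
    simp [insertFirst, lieD, ceD, Fin.sum_univ_succ, h]
    abel
  | succ n =>
    have h (j : Fin (n + 2)) :
        (fun k => (Fin.cons x z : Fin (n + 3) → g) (j.succ.succAbove k)) =
          Fin.cons x (fun k => z (j.succAbove k)) := by
      funext k
      refine Fin.cases ?_ (fun k => ?_) k <;> simp
    have h2 (j i : Fin (n + 2)) (hij : (i : ℕ) < j) (p : (i : ℕ) + 1 < n + 2) (p') :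
        (fun k => (Fin.cons x z : Fin (n + 3) → g)
          (j.succ.succAbove ((⟨(i : ℕ) + 1, p⟩ : Fin (n + 2)).succAbove k))) =
          Fin.cons x (fun k => z (j.succAbove ((⟨i, p'⟩ : Fin (n + 1)).succAbove k))) := by
      funext k
      have : (⟨(i : ℕ) + 1, p⟩ : Fin (n + 2)) = Fin.succ ⟨i, p'⟩ := rfl
      rw [this]
      refine Fin.cases ?_ (fun k => ?_) k <;> simp [-Fin.succ_mk]
    have h0 (j : Fin (n + 2)) (p : 0 < n + 2) :
        (fun k => (Fin.cons x z : Fin (n + 3) → g)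
          (j.succ.succAbove ((⟨0, p⟩ : Fin (n + 2)).succAbove k))) =
          (fun k => z (j.succAbove k)) := by
      funext k
      have : (⟨0, p⟩ : Fin (n + 2)) = 0 := rfl
      rw [this]
      simp
    simp only [insertFirst, lieD, ceD, Pi.sub_apply, Fin.sum_univ_succ (n := n + 2),
      Fin.cons_zero, Fin.cons_succ, h, Fin.val_succ, Fin.val_zero, pow_zero, one_smul,
      Fin.zero_succAbove, not_lt_zero, dite_false, zero_add, Nat.succ_pos, dite_true,
      h0, add_lt_add_iff_right]
    have hsum (i j : Fin (n + 2)) :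
        (if hij : (i : ℕ) < j then
          (-1 : ℤ) ^ ((i : ℕ) + 1 + ((j : ℕ) + 1)) •
            f (Fin.cons (br (z i) (z j)) (fun k => (Fin.cons x z : Fin (n + 3) → g)
              (j.succ.succAbove ((⟨(i : ℕ) + 1, by omega⟩ : Fin (n + 2)).succAbove k))))
        else 0) =
        -(if hij : (i : ℕ) < j then
          (-1 : ℤ) ^ ((i : ℕ) + (j : ℕ)) •
            f (Fin.cons x (Fin.cons (br (z i) (z j)) (fun k =>
              z (j.succAbove ((⟨(i : ℕ), by omega⟩ : Fin (n + 1)).succAbove k)))))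
        else 0) := by
      split_ifs with hij
      · rw [h2 j i hij _ (by omega), hf.cons_swap, smul_neg]
        congr 2
        ring
      · rw [neg_zero]
    simp only [hsum, Finset.sum_neg_distrib, pow_succ, mul_neg, mul_one, neg_smul]
    abel

theorem IsCochain.lieD (hb : IsLieBr K br) (hr : IsRep K br ρ) {n : ℕ} {f : (Fin n → g) → V}
    (hf : IsCochain n f) (x : g) : IsCochain n (lieD br ρ x n f) := by
  induction n with
  | zero => trivial
  | succ n ih =>
    refine ⟨fun y z => ?_, fun y => ?_, ?_⟩
    · simp only [insertFirst_lieD hf, hf.1, hb.1.2.2.1, lieD_add hr]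
      abel
    · rw [insertFirst_lieD hf]
      exact (ih (hf.2.1 y)).sub (hf.2.1 _)
    · cases n with
      | zero => trivial
      | succ n =>
        intro y z
        simp only [insertFirst_lieD hf, insertFirst_sub, insertFirst_lieD (hf.2.1 _),
          hf.2.2 y z,
          hf.2.2 (br x y) z, hf.2.2 (br x z) y, lieD_neg hr]
        abel

theorem lieD_br (hb : IsLieBr K br) (hr : IsRep K br ρ) {n : ℕ} {f : (Fin n → g) → V}
    (hf : IsCochain n f) (x y : g) :
    lieD br ρ (br x y) n f =
      lieD br ρ x n (lieD br ρ y n f) - lieD br ρ y n (lieD br ρ x n f) := by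
  induction n with
  | zero => funext z; exact hr.2.2.2 _ _ _
  | succ n ih =>
    refine insertFirst_ext fun z => ?_
    simp only [insertFirst_sub, insertFirst_lieD hf, insertFirst_lieD (hf.lieD hb hr _),
      lieD_sub hr, ih (hf.2.1 z), hb.leibniz x y z, hf.1]
    abel

theorem IsCochain.ceD (hb : IsLieBr K br) (hr : IsRep K br ρ) {n : ℕ} {f : (Fin n → g) → V}
    (hf : IsCochain n f) : IsCochain (n + 1) (ceD br ρ n f) := by
  induction n with
  | zero =>
    refine ⟨fun y z => ?_, fun y => trivial, trivial⟩
    simp only [insertFirst_ceD_zero, lieD_add_arg hb hr hf]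
  | succ n ih =>
    refine ⟨fun y z => ?_, fun y => ?_, ?_⟩
    · simp only [insertFirst_ceD hf, hf.1, lieD_add_arg hb hr hf, ceD_add hr]
      abel
    · rw [insertFirst_ceD hf]
      exact (hf.lieD hb hr y).sub (ih (hf.2.1 y))
    · intro y z
      cases n with
      | zero =>
        simp only [insertFirst_ceD hf, insertFirst_sub, insertFirst_lieD hf,
          insertFirst_ceD_zero, hb.skew z y, hf.insertFirst_neg_arg]
        abel
      | succ n =>
        simp only [insertFirst_ceD hf, insertFirst_sub, insertFirst_lieD hf,
          insertFirst_ceD (hf.2.1 _), hb.skew z y, hf.insertFirst_neg_arg, hf.2.2 z y,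
          ceD_neg hr]
        abel

theorem lieD_ceD (hb : IsLieBr K br) (hr : IsRep K br ρ) {n : ℕ} {f : (Fin n → g) → V}
    (hf : IsCochain n f) (x : g) :
    lieD br ρ x (n + 1) (ceD br ρ n f) = ceD br ρ n (lieD br ρ x n f) := by
  induction n with
  | zero =>
    refine insertFirst_ext fun y => ?_
    simp only [insertFirst_lieD (hf.ceD hb hr), insertFirst_ceD_zero, lieD_br hb hr hf]
    abel
  | succ n ih =>
    refine insertFirst_ext fun y => ?_
    simp only [insertFirst_lieD (hf.ceD hb hr), insertFirst_ceD hf, lieD_br hb hr hf,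
      insertFirst_ceD (hf.lieD hb hr x), insertFirst_lieD hf, lieD_sub hr, ceD_sub hr,
      ih (hf.2.1 y)]
    abel

theorem ceD_ceD (hb : IsLieBr K br) (hr : IsRep K br ρ) {n : ℕ} {f : (Fin n → g) → V}
    (hf : IsCochain n f) : ceD br ρ (n + 1) (ceD br ρ n f) = 0 := by
  induction n with
  | zero =>
    refine insertFirst_ext fun x => ?_
    rw [insertFirst_ceD (hf.ceD hb hr), insertFirst_ceD_zero, lieD_ceD hb hr hf, sub_self]
    rfl
  | succ n ih =>
    refine insertFirst_ext fun x => ?_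
    rw [insertFirst_ceD (hf.ceD hb hr), insertFirst_ceD hf, lieD_ceD hb hr hf, ceD_sub hr,
      ih (hf.2.1 x), sub_zero, sub_self]
    rfl

end Cartan

section Pencil

variable {K g V : Type*} [Field K] [AddCommGroup g] [Module K g] [AddCommGroup V] [Module K V]
  {br1 br2 : g → g → g} {ρ μ : g → V → V}

theorem IsCompatLie.isLieBr_add (hc : IsCompatLie K br1 br2) : IsLieBr K (br1 + br2) := by
  obtain ⟨⟨⟨a1, a2, a3, a4⟩, a5, a6⟩, ⟨⟨b1, b2, b3, b4⟩, b5, b6⟩, h⟩ := hc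
  refine ⟨⟨?_, ?_, ?_, ?_⟩, ?_, ?_⟩
  · intro x y z; simp only [Pi.add_apply, a1, b1]; abel
  · intro c x y; simp only [Pi.add_apply, a2, b2, smul_add]
  · intro x y z; simp only [Pi.add_apply, a3, b3]; abel
  · intro c x y; simp only [Pi.add_apply, a4, b4, smul_add]
  · intro x; simp only [Pi.add_apply, a5, b5, add_zero]
  · intro x y z
    simp only [Pi.add_apply, a1, b1]
    have := congrArg₂ (· + ·) (congrArg₂ (· + ·) (a6 x y z) (b6 x y z)) (h x y z)
    simp only [add_zero] at this
    rw [← this]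
    abel

theorem IsCompatRep.isRep_add (hrep : IsCompatRep K br1 br2 ρ μ) :
    IsRep K (br1 + br2) (ρ + μ) := by
  obtain ⟨⟨a1, a2, a3, a4⟩, ⟨b1, b2, b3, b4⟩, h⟩ := hrep
  refine ⟨fun x => ⟨?_, ?_⟩, ?_, ?_, ?_⟩
  · intro v w; simp only [Pi.add_apply, (a1 x).map_add, (b1 x).map_add]; abel
  · intro c v; simp only [Pi.add_apply, (a1 x).map_smul, (b1 x).map_smul, smul_add]
  · intro x y v; simp only [Pi.add_apply, a2, b2]; abel
  · intro c x v; simp only [Pi.add_apply, a3, b3, smul_add]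
  · intro x y v
    simp only [Pi.add_apply, a2, b2, a4, b4, (a1 _).map_add, (b1 _).map_add]
    have := h x y v
    rw [← sub_eq_zero] at this ⊢
    rw [← this]
    abel

theorem ceD_add_bracket {n : ℕ} {f : (Fin n → g) → V} (hf : IsCochain n f) :
    ceD (br1 + br2) (ρ + μ) n f = ceD br1 ρ n f + ceD br2 μ n f := by
  funext y
  cases n with
  | zero => rfl
  | succ n =>
    simp only [ceD, Pi.add_apply, smul_add, Finset.sum_add_distrib, hf.cons_add]
    rw [add_add_add_comm]
    congr 1
    simp only [← Finset.sum_add_distrib]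
    refine Finset.sum_congr rfl fun i _ => Finset.sum_congr rfl fun j _ => ?_
    split_ifs <;> simp

end Pencil
/-- For a compatible Lie algebra `(g, br1, br2)` with a representation
`(V; ρ, μ)`, the two Chevalley–Eilenberg coboundary operators `d₁` (for `br1`, `ρ`) and
`d₂` (for `br2`, `μ`) on alternating cochains satisfy `d₁² = 0`, `d₂² = 0` and
`d₁d₂ + d₂d₁ = 0` in every degree `n ≥ 0`. -/
theorem ce_coboundaries_square_zero_and_anticommute {K g V : Type*} [Field K] [CharZero K]
    [AddCommGroup g] [Module K g] [AddCommGroup V] [Module K V]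
    (br1 br2 : g → g → g) (ρ μ : g → V → V)
    (hc : IsCompatLie K br1 br2) (hrep : IsCompatRep K br1 br2 ρ μ)
    (n : ℕ) (f : AlternatingMap K g V (Fin n)) :
    ceD br1 ρ (n + 1) (ceD br1 ρ n ⇑f) = 0 ∧
    ceD br2 μ (n + 1) (ceD br2 μ n ⇑f) = 0 ∧
    ceD br1 ρ (n + 1) (ceD br2 μ n ⇑f) + ceD br2 μ (n + 1) (ceD br1 ρ n ⇑f) = 0 := by
  obtain ⟨hb1, hb2, -⟩ := id hc
  obtain ⟨hr1, hr2, -⟩ := id hrep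
  have hf := f.isCochain
  have h1 := ceD_ceD hb1 hr1 hf
  have h2 := ceD_ceD hb2 hr2 hf
  refine ⟨h1, h2, ?_⟩
  have h := ceD_ceD hc.isLieBr_add hrep.isRep_add hf
  rw [ceD_add_bracket hf, ceD_add_bracket ((hf.ceD hb1 hr1).add (hf.ceD hb2 hr2)),
    ceD_add hr1, ceD_add hr2, h1, h2, zero_add, add_zero] at h
  exact h
end

section
/- Let (g,[-,-],{-,-}) be a compatible Lie algebra over a field K of characteristic 0 and let (V; ρ, μ) be a representation of g. Define the cochain complex: C^0(g,V) = {v ∈ V : ρ(x)v = μ(x)v for all x ∈ g}, and for n ≥ 1, C^n(g,V) is the direct sum of n copies of the space of alternating n-linear maps from g to V. Define δ^0 v = d1^0 v (where (d1^0 v)(x) = ρ(x)v), δ^1 f = (d1^1 f, d2^1 f), and for n ≥ 2, δ^n(ω_1,…,ω_n) = (d1^n ω_1, d2^n ω_1 + d1^n ω_2, …, d2^n ω_{i−1} + d1^n ω_i, …, d2^n ω_n), where d1^n and d2^n are the Chevalley–Eilenberg coboundary operators of (g,[-,-]) with coefficients in ρ and of (g,{-,-}) with coefficients in μ respectively. Then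 δ^{n+1} ∘ δ^n = 0 for all n ≥ 0. -/
/-- The coboundary operator `δⁿ` of the compatible cochain complex, for `n ≥ 1`:
`δⁿ(ω₁,…,ωₙ) = (d₁ω₁, d₂ω₁ + d₁ω₂, …, d₂ω_{i-1} + d₁ωᵢ, …, d₂ωₙ)`,
where an element of `𝔠ⁿ(g,V)` (the direct sum of `n` copies of the `n`-cochains) is
recorded as a tuple indexed by `Fin n`. -/
def compDelta {g V : Type*} [AddCommGroup V] (br1 br2 : g → g → g) (ρ μ : g → V → V)
    (n : ℕ) (ω : Fin n → ((Fin n → g) → V)) : Fin (n + 1) → ((Fin (n + 1) → g) → V) :=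
  fun i =>
    (if h : (i : ℕ) < n then ceD br1 ρ n (ω ⟨(i : ℕ), h⟩) else 0) +
    (if h : 0 < (i : ℕ) then
        ceD br2 μ n (ω ⟨(i : ℕ) - 1, by have := i.isLt; omega⟩)
      else 0)

open Function in
/-- The derivation extension of a linear endomorphism `a` to alternating maps:
`(v₁, …, vₙ) ↦ ∑ⱼ f(v₁, …, a vⱼ, …, vₙ)`. -/
def AlternatingMap.sumComp {K g V : Type*} [Field K] [AddCommGroup g] [Module K g]
    [AddCommGroup V] [Module K V] {n : ℕ} (a : g →ₗ[K] g) (f : g [⋀^Fin n]→ₗ[K] V) :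
    g [⋀^Fin n]→ₗ[K] V where
  toMultilinearMap :=
    ∑ j, f.toMultilinearMap.compLinearMap (update (fun _ => LinearMap.id) j a)
  map_eq_zero_of_eq' v p q hv hpq := by
    have key (j : Fin n) : (fun i => update (fun _ => LinearMap.id) j a i (v i)) =
        update v j (a (v j)) := by
      ext i
      rcases eq_or_ne i j with rfl | h <;> simp [*]
    suffices ∑ j, f (update v j (a (v j))) = 0 by simpa [key]
    rw [Fintype.sum_eq_add p q hpq]
    · have : update v q (a (v q)) = update v p (a (v p)) ∘ Equiv.swap p q := by
        ext i
        rcases eq_or_ne i p with rfl | hp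
        · simp [hpq, hv, hpq.symm]
        · rcases eq_or_ne i q with rfl | hq
          · simp [hv]
          · simp [Equiv.swap_apply_of_ne_of_ne, hp, hq]
      rw [this, f.map_swap _ hpq, add_neg_cancel]
    · rintro j ⟨hp, hq⟩
      exact f.map_eq_zero_of_eq _ (by simp [hp.symm, hq.symm, hv]) hpq

namespace AlternatingMap

variable {K g V : Type*} [Field K] [AddCommGroup g] [Module K g] [AddCommGroup V] [Module K V]
  {n : ℕ}

open Function

theorem sumComp_apply (a : g →ₗ[K] g) (f : g [⋀^Fin n]→ₗ[K] V) (v : Fin n → g) :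
    sumComp a f v = ∑ j, f (update v j (a (v j))) := by
  have key (j : Fin n) : (fun i => update (fun _ => LinearMap.id) j a i (v i)) =
      update v j (a (v j)) := by
    ext i
    rcases eq_or_ne i j with rfl | h <;> simp [*]
  change (∑ j, f.toMultilinearMap.compLinearMap (update (fun _ => LinearMap.id) j a)) v = _
  simp [key]

theorem curryLeft_sumComp (a : g →ₗ[K] g) (f : g [⋀^Fin (n + 1)]→ₗ[K] V) (x : g) :
    (sumComp a f).curryLeft x = f.curryLeft (a x) + sumComp a (f.curryLeft x) := by
  ext v
  simp [sumComp_apply, Fin.sum_univ_succ, Matrix.vecCons, ← Fin.cons_update]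

/-- The Lie derivative of alternating maps determined by endomorphisms `a` of the source and
`r` of the target. -/
def lieDer (a : g →ₗ[K] g) (r : V →ₗ[K] V) (f : g [⋀^Fin n]→ₗ[K] V) : g [⋀^Fin n]→ₗ[K] V :=
  r.compAlternatingMap f - sumComp a f

theorem lieDer_apply (a : g →ₗ[K] g) (r : V →ₗ[K] V) (f : g [⋀^Fin n]→ₗ[K] V) (v : Fin n → g) :
    lieDer a r f v = r (f v) - ∑ j, f (update v j (a (v j))) := by
  simp [lieDer, sumComp_apply]

theorem lieDer_sub (a : g →ₗ[K] g) (r : V →ₗ[K] V) (f f' : g [⋀^Fin n]→ₗ[K] V) :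
    lieDer a r (f - f') = lieDer a r f - lieDer a r f' := by
  ext v
  simp only [lieDer_apply, sub_apply, map_sub, Finset.sum_sub_distrib]
  abel

theorem curryLeft_sub (f f' : g [⋀^Fin (n + 1)]→ₗ[K] V) (x : g) :
    (f - f').curryLeft x = f.curryLeft x - f'.curryLeft x := rfl

theorem ext_curryLeft {f f' : g [⋀^Fin (n + 1)]→ₗ[K] V}
    (h : ∀ x, f.curryLeft x = f'.curryLeft x) : f = f' := by
  ext v
  have := DFunLike.congr_fun (h (v 0)) (Fin.tail v)
  simpa [Matrix.vecCons] using this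

theorem curryLeft_lieDer (a : g →ₗ[K] g) (r : V →ₗ[K] V) (f : g [⋀^Fin (n + 1)]→ₗ[K] V) (x : g) :
    (lieDer a r f).curryLeft x = lieDer a r (f.curryLeft x) - f.curryLeft (a x) := by
  rw [lieDer, curryLeft_sub, curryLeft_sumComp, AlternatingMap.curryLeft_compAlternatingMap, lieDer]
  abel

theorem lieDer_comm (a b : g →ₗ[K] g) (r s : V →ₗ[K] V) (f : g [⋀^Fin n]→ₗ[K] V) :
    lieDer a r (lieDer b s f) - lieDer b s (lieDer a r f) =
      lieDer (a ∘ₗ b - b ∘ₗ a) (r ∘ₗ s - s ∘ₗ r) f := by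
  induction n with
  | zero => ext v; simp [lieDer_apply]
  | succ n ih =>
    refine ext_curryLeft fun x => ?_
    simp only [curryLeft_lieDer, curryLeft_sub, lieDer_sub, ← ih, LinearMap.sub_apply,
      LinearMap.comp_apply, map_sub]
    abel

/-- The Chevalley–Eilenberg coboundary of an alternating map, as an alternating map. -/
def coboundary (B : g →ₗ[K] g →ₗ[K] g) (R : g →ₗ[K] V →ₗ[K] V) (f : g [⋀^Fin n]→ₗ[K] V) :
    g [⋀^Fin (n + 1)]→ₗ[K] V :=
  alternatizeUncurryFin
    { toFun := fun x => (R x).compAlternatingMap f - (2⁻¹ : K) • sumComp (B x) f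
      map_add' := fun x y => by
        ext v
        simp only [sumComp_apply, sub_apply, smul_apply, map_add, LinearMap.add_apply,
          LinearMap.compAlternatingMap_apply, add_apply, map_update_add, Finset.sum_add_distrib]
        module
      map_smul' := fun c x => by
        ext v
        simp only [sumComp_apply, sub_apply, smul_apply, map_smul, LinearMap.smul_apply,
          LinearMap.compAlternatingMap_apply, map_update_smul, ← Finset.smul_sum,
          RingHom.id_apply]
        module }

theorem coboundary_apply (B : g →ₗ[K] g →ₗ[K] g) (R : g →ₗ[K] V →ₗ[K] V)
    (f : g [⋀^Fin n]→ₗ[K] V) (v : Fin (n + 1) → g) :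
    coboundary B R f v = ∑ i : Fin (n + 1), (-1 : ℤ) ^ (i : ℕ) •
      (R (v i) (f (i.removeNth v)) - (2⁻¹ : K) • sumComp (B (v i)) f (i.removeNth v)) := by
  simp [coboundary, alternatizeUncurryFin_apply]

theorem coboundary_sub (B : g →ₗ[K] g →ₗ[K] g) (R : g →ₗ[K] V →ₗ[K] V)
    (f f' : g [⋀^Fin n]→ₗ[K] V) :
    coboundary B R (f - f') = coboundary B R f - coboundary B R f' := by
  ext v
  simp only [coboundary_apply, sub_apply, ← Finset.sum_sub_distrib, ← smul_sub]
  refine Finset.sum_congr rfl fun i _ => ?_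
  simp only [sumComp_apply, sub_apply, Finset.sum_sub_distrib, map_sub]
  module

theorem coboundary_add (B : g →ₗ[K] g →ₗ[K] g) (R : g →ₗ[K] V →ₗ[K] V)
    (f f' : g [⋀^Fin n]→ₗ[K] V) :
    coboundary B R (f + f') = coboundary B R f + coboundary B R f' := by
  ext v
  simp only [coboundary_apply, add_apply, ← Finset.sum_add_distrib, ← smul_add]
  refine Finset.sum_congr rfl fun i _ => ?_
  simp only [sumComp_apply, add_apply, Finset.sum_add_distrib, map_add]
  module

theorem coboundary_zero (B : g →ₗ[K] g →ₗ[K] g) (R : g →ₗ[K] V →ₗ[K] V) :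
    coboundary B R (0 : g [⋀^Fin n]→ₗ[K] V) = 0 := by
  simpa using coboundary_sub B R (0 : g [⋀^Fin n]→ₗ[K] V) 0

theorem add_coboundary (B B' : g →ₗ[K] g →ₗ[K] g) (R R' : g →ₗ[K] V →ₗ[K] V)
    (f : g [⋀^Fin n]→ₗ[K] V) :
    coboundary (B + B') (R + R') f = coboundary B R f + coboundary B' R' f := by
  ext v
  simp only [coboundary_apply, add_apply, ← Finset.sum_add_distrib, ← smul_add]
  refine Finset.sum_congr rfl fun i _ => ?_
  simp only [sumComp_apply, LinearMap.add_apply, map_update_add, Finset.sum_add_distrib]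
  module

theorem coboundary_of_isEmpty (B : g →ₗ[K] g →ₗ[K] g) (R : g →ₗ[K] V →ₗ[K] V)
    (f : g [⋀^Fin 0]→ₗ[K] V) (v : Fin 1 → g) :
    coboundary B R f v = R (v 0) (f ![]) := by
  simp [coboundary_apply, sumComp_apply, Subsingleton.elim (Fin.removeNth 0 v) ![]]

theorem map_update_eq_map_vecCons_removeNth (f : g [⋀^Fin (n + 1)]→ₗ[K] V) (v : Fin (n + 1) → g)
    (j : Fin (n + 1)) (x : g) :
    f (update v j x) = (-1 : ℤ) ^ (j : ℕ) • f (Matrix.vecCons x (j.removeNth v)) := by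
  rw [← Fin.insertNth_removeNth, map_insertNth]

/-- Cartan's formula. -/
theorem curryLeft_coboundary [CharZero K] (B : g →ₗ[K] g →ₗ[K] g) (R : g →ₗ[K] V →ₗ[K] V)
    (hB : ∀ x y, B x y = -B y x) (f : g [⋀^Fin (n + 1)]→ₗ[K] V) (x : g) :
    (coboundary B R f).curryLeft x = lieDer (B x) (R x) f - coboundary B R (f.curryLeft x) := by
  ext v
  have hrem (i : Fin (n + 1)) : i.succ.removeNth (Matrix.vecCons x v) =
      Matrix.vecCons x (i.removeNth v) := by
    ext k
    cases k using Fin.cases <;> simp [Fin.removeNth]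
  have hS (y : g) (w : Fin n → g) : sumComp (B y) f (Matrix.vecCons x w) =
      f (Matrix.vecCons (B y x) w) + sumComp (B y) (f.curryLeft x) w :=
    DFunLike.congr_fun (curryLeft_sumComp (B y) f x) w
  have hneg (y : g) (w : Fin n → g) : f (Matrix.vecCons (-y) w) = -f (Matrix.vecCons y w) :=
    DFunLike.congr_fun (map_neg f.curryLeft y) w
  have h0 : Fin.removeNth 0 (Matrix.vecCons x v) = v := by
    ext k; simp [Fin.removeNth]
  rw [curryLeft_apply_apply, coboundary_apply, Fin.sum_univ_succ]
  simp only [hrem, h0, hS, sub_apply, coboundary_apply, lieDer_apply, sumComp_apply (B x),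
    map_update_eq_map_vecCons_removeNth f, Matrix.cons_val_succ, Matrix.cons_val_zero,
    curryLeft_apply_apply, hB _ x, hneg, Fin.val_succ, Fin.val_zero, pow_zero, one_smul, pow_succ]
  simp only [sub_sub, smul_add, smul_sub, mul_neg, mul_one, neg_smul, smul_neg, Finset.sum_add_distrib,
    Finset.sum_neg_distrib, Finset.sum_sub_distrib, Finset.smul_sum, ← smul_comm (2⁻¹ : K)]
  simp only [← Finset.smul_sum]
  module

/-- The Lie derivative commutes with the coboundary. -/
theorem lieDer_coboundary [CharZero K] (B : g →ₗ[K] g →ₗ[K] g) (R : g →ₗ[K] V →ₗ[K] V)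
    (hB : ∀ x y, B x y = -B y x)
    (hJ : ∀ x y, B (B x y) = B x ∘ₗ B y - B y ∘ₗ B x)
    (hR : ∀ x y, R (B x y) = R x ∘ₗ R y - R y ∘ₗ R x)
    (f : g [⋀^Fin n]→ₗ[K] V) (x : g) :
    lieDer (B x) (R x) (coboundary B R f) = coboundary B R (lieDer (B x) (R x) f) := by
  induction n with
  | zero =>
    ext v
    simp [lieDer_apply, coboundary_of_isEmpty, hR]
  | succ n ih =>
    refine ext_curryLeft fun y => ?_
    simp only [curryLeft_lieDer, curryLeft_coboundary B R hB, lieDer_sub, coboundary_sub, ih, hJ,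
      hR, ← lieDer_comm]
    abel

/-- The Chevalley–Eilenberg coboundary squares to zero. -/
theorem coboundary_coboundary [CharZero K] (B : g →ₗ[K] g →ₗ[K] g) (R : g →ₗ[K] V →ₗ[K] V)
    (hB : ∀ x y, B x y = -B y x)
    (hJ : ∀ x y, B (B x y) = B x ∘ₗ B y - B y ∘ₗ B x)
    (hR : ∀ x y, R (B x y) = R x ∘ₗ R y - R y ∘ₗ R x)
    (f : g [⋀^Fin n]→ₗ[K] V) : coboundary B R (coboundary B R f) = 0 := by
  induction n with
  | zero =>
    refine ext_curryLeft fun x => ext_curryLeft fun y => ?_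
    ext v
    simp [curryLeft_coboundary B R hB, curryLeft_lieDer, lieDer_apply, coboundary_of_isEmpty,
      curryLeft_sub, hR]
  | succ n ih =>
    refine ext_curryLeft fun x => ?_
    simp [curryLeft_coboundary B R hB, coboundary_sub, ih, lieDer_coboundary B R hB hJ hR]

/-- The coboundaries of a compatible pair of brackets and actions anticommute. -/
theorem coboundary_anticomm [CharZero K] (B B' : g →ₗ[K] g →ₗ[K] g) (R R' : g →ₗ[K] V →ₗ[K] V)
    (hB : ∀ x y, B x y = -B y x)
    (hJ : ∀ x y, B (B x y) = B x ∘ₗ B y - B y ∘ₗ B x)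
    (hR : ∀ x y, R (B x y) = R x ∘ₗ R y - R y ∘ₗ R x)
    (hB' : ∀ x y, B' x y = -B' y x)
    (hJ' : ∀ x y, B' (B' x y) = B' x ∘ₗ B' y - B' y ∘ₗ B' x)
    (hR' : ∀ x y, R' (B' x y) = R' x ∘ₗ R' y - R' y ∘ₗ R' x)
    (hJJ : ∀ x y, B (B' x y) + B' (B x y) =
      B x ∘ₗ B' y - B' y ∘ₗ B x + B' x ∘ₗ B y - B y ∘ₗ B' x)
    (hRR : ∀ x y, R (B' x y) + R' (B x y) =
      R x ∘ₗ R' y - R' y ∘ₗ R x + R' x ∘ₗ R y - R y ∘ₗ R' x)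
    (f : g [⋀^Fin n]→ₗ[K] V) :
    coboundary B R (coboundary B' R' f) + coboundary B' R' (coboundary B R f) = 0 := by
  have h := coboundary_coboundary (B + B') (R + R')
    (fun x y => by simp only [LinearMap.add_apply, hB x y, hB' x y]; abel)
    (fun x y => by
      simp only [LinearMap.add_apply, map_add, LinearMap.add_comp, LinearMap.comp_add]
      rw [add_add_add_comm, add_comm (B' (B x y)), add_add_add_comm, hJ, hJ',
        hJJ]
      abel)
    (fun x y => by
      simp only [LinearMap.add_apply, map_add, LinearMap.add_comp, LinearMap.comp_add]
      rw [add_add_add_comm, add_comm (R' (B x y)), add_add_add_comm, hR, hR',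
        hRR]
      abel) f
  simp only [add_coboundary, coboundary_add, coboundary_coboundary B R hB hJ hR,
    coboundary_coboundary B' R' hB' hJ' hR', zero_add, add_zero] at h
  exact (add_comm _ _).trans h

/-- Cartan's formula for the explicit Chevalley–Eilenberg coboundary. -/
theorem ceD_vecCons (B : g →ₗ[K] g →ₗ[K] g) (R : g →ₗ[K] V →ₗ[K] V)
    (f : g [⋀^Fin (n + 1)]→ₗ[K] V) (x : g) (v : Fin (n + 1) → g) :
    ceD (fun x y => B x y) (fun x => R x) (n + 1) f (Matrix.vecCons x v) =
      lieDer (B x) (R x) f v - ceD (fun x y => B x y) (fun x => R x) n (f.curryLeft x) v := by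
  have hcons (i : Fin (n + 1)) : (fun k => Matrix.vecCons x v (i.succ.succAbove k)) =
      Matrix.vecCons x (i.removeNth v) := by
    ext k
    cases k using Fin.cases <;> simp [Fin.removeNth]
  have hcurry : ceD (fun x y => B x y) (fun x => R x) n (f.curryLeft x) v =
      ∑ i : Fin (n + 1), (-1 : ℤ) ^ (i : ℕ) • R (v i) (f (Matrix.vecCons x (i.removeNth v))) -
      ∑ i : Fin (n + 1), ∑ j : Fin (n + 1),
        if h : (i.succ : ℕ) < (j.succ : ℕ) then
          (-1 : ℤ) ^ ((i.succ : ℕ) + (j.succ : ℕ)) •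
            f (Fin.cons (B (v i) (v j))
                (fun k : Fin n =>
                  Matrix.vecCons x v (j.succ.succAbove
                      ((⟨(i.succ : ℕ), lt_of_lt_of_le h (Nat.lt_succ_iff.mp j.succ.isLt)⟩ :
                        Fin (n + 1)).succAbove k))))
        else 0 := by
    cases n with
    | zero =>
      have hv : Fin.tail v = Fin.elim0 := Subsingleton.elim _ _
      simp [ceD, hv, Matrix.vecCons]
    | succ m =>
      simp only [ceD]
      rw [sub_eq_add_neg, ← Finset.sum_neg_distrib]
      refine congrArg₂ (· + ·) rfl ?_
      refine Finset.sum_congr rfl fun i _ => ?_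
      rw [← Finset.sum_neg_distrib]
      refine Finset.sum_congr rfl fun j _ => ?_
      by_cases h : (i : ℕ) < j
      · have h' : (i.succ : ℕ) < j.succ := by simpa using h
        rw [dif_pos h, dif_pos h', curryLeft_apply_apply]
        have hs : (-1 : ℤ) ^ ((i.succ : ℕ) + (j.succ : ℕ)) = (-1) ^ ((i : ℕ) + j) := by
          simp only [Fin.val_succ]; ring
        rw [hs, ← smul_neg]
        congr 1
        rw [← f.map_swap _ (Fin.zero_ne_one)]
        congr 1
        ext k
        have hi : (⟨(i.succ : ℕ), lt_of_lt_of_le h' (Nat.lt_succ_iff.mp j.succ.isLt)⟩ :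
            Fin (m + 2)) = Fin.succ ⟨(i : ℕ), lt_of_lt_of_le h (Nat.lt_succ_iff.mp j.isLt)⟩ := rfl
        rw [hi]
        generalize (⟨(i : ℕ), lt_of_lt_of_le h (Nat.lt_succ_iff.mp j.isLt)⟩ : Fin (m + 1)) = p
        refine Fin.cases ?_ (fun k => ?_) k
        · simp [Matrix.vecCons]
        · refine Fin.cases ?_ (fun k => ?_) k
          · simp [Matrix.vecCons]
          · have h0 : (k.succ.succ : Fin (m + 2)) ≠ 0 := Fin.succ_ne_zero _
            have h1 : (k.succ.succ : Fin (m + 2)) ≠ 1 := by simp [Fin.ext_iff]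
            rw [Function.comp_apply, Equiv.swap_apply_of_ne_of_ne h0 h1]
            simp [Matrix.vecCons]
      · have h' : ¬ (i.succ : ℕ) < j.succ := by simpa using h
        rw [dif_neg h, dif_neg h', neg_zero]
  have hact : ∑ i : Fin (n + 2), (-1 : ℤ) ^ (i : ℕ) • R (Matrix.vecCons x v i)
        (f (fun k => Matrix.vecCons x v (i.succAbove k))) =
      R x (f v) -
        ∑ i : Fin (n + 1), (-1 : ℤ) ^ (i : ℕ) • R (v i) (f (Matrix.vecCons x (i.removeNth v))) := by
    rw [Fin.sum_univ_succ, sub_eq_add_neg, ← Finset.sum_neg_distrib]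
    simp [hcons, pow_succ]
  have hpair : ∀ j : Fin (n + 1), (-1 : ℤ) ^ ((0 : ℕ) + (j.succ : ℕ)) •
      f (Fin.cons (B x (v j)) fun k => Matrix.vecCons x v (j.succ.succAbove (Fin.succAbove 0 k))) =
      -f (Function.update v j (B x (v j))) := by
    intro j
    rw [map_update_eq_map_vecCons_removeNth, zero_add, Fin.val_succ, pow_succ, mul_neg_one,
      neg_smul]
    congr 3
    ext k
    cases k using Fin.cases <;> simp [Matrix.vecCons, Fin.removeNth]
  rw [hcurry, lieDer_apply]
  simp only [ceD]
  rw [hact, Fin.sum_univ_succ (n := n + 1)]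
  have hcombine (a b s t s' t' : V) (h : s = -t) (h' : s' = t') :
      a - b + (s + s') = a - t - (b - t') := by
    rw [h, h']; abel
  refine hcombine _ _ _ _ _ _ ?_ (Finset.sum_congr rfl fun i _ => ?_)
  · rw [Fin.sum_univ_succ, dif_neg (by simp), zero_add, ← Finset.sum_neg_distrib]
    refine Finset.sum_congr rfl fun j _ => ?_
    rw [dif_pos (by simp)]
    exact hpair j
  · rw [Fin.sum_univ_succ, dif_neg (by simp), zero_add]
    rfl

theorem coe_coboundary [CharZero K] (B : g →ₗ[K] g →ₗ[K] g) (R : g →ₗ[K] V →ₗ[K] V)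
    (hB : ∀ x y, B x y = -B y x) (f : g [⋀^Fin n]→ₗ[K] V) :
    ⇑(coboundary B R f) = ceD (fun x y => B x y) (fun x => R x) n f := by
  induction n with
  | zero =>
    ext v
    rw [coboundary_of_isEmpty, ceD]
    congr 2
  | succ n ih =>
    ext v
    rw [← Matrix.cons_head_tail v, ceD_vecCons, ← ih, ← curryLeft_apply_apply,
      curryLeft_coboundary B R hB, sub_apply]

/-- The coboundary of the compatible complex on sequences of alternating maps. -/
theorem compDelta_apply [CharZero K] (B B' : g →ₗ[K] g →ₗ[K] g) (R R' : g →ₗ[K] V →ₗ[K] V)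
    (hB : ∀ x y, B x y = -B y x) (hB' : ∀ x y, B' x y = -B' y x)
    (ω : Fin n → (Fin n → g) → V) (w : ℕ → g [⋀^Fin n]→ₗ[K] V)
    (hw : ∀ i : Fin n, ω i = w i) (hw0 : ∀ i, n ≤ i → w i = 0) (i : Fin (n + 1)) :
    compDelta (fun x y => B x y) (fun x y => B' x y) (fun x => R x) (fun x => R' x) n ω i =
      ⇑(coboundary B R (w i) + if 0 < (i : ℕ) then coboundary B' R' (w (i - 1)) else 0) := by
  change _ = ⇑(coboundary B R (w i)) + ⇑(ite (0 < (i : ℕ)) (coboundary B' R' (w (i - 1))) 0)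
  rw [compDelta]
  congr 1
  · split_ifs with h
    · rw [coe_coboundary B R hB, hw]
    · rw [hw0 i (by omega), coboundary_zero]; rfl
  · split_ifs with h
    · rw [coe_coboundary B' R' hB', hw]
    · rfl

end AlternatingMap

/-- For a compatible Lie algebra `(g, br1, br2)` with representation
`(V; ρ, μ)`, the coboundary `δ` of the compatible cochain complex satisfies
`δ^{n+1} ∘ δⁿ = 0` for all `n ≥ 0`: in degree `0` (where `𝔠⁰(g,V)` consists of those
`v ∈ V` with `ρ(x)v = μ(x)v` and `δ⁰v = d₁⁰v`), and in all degrees `n ≥ 1` on tuples of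
alternating `n`-cochains. -/
theorem compDelta_squared_eq_zero {K g V : Type*} [Field K] [CharZero K]
    [AddCommGroup g] [Module K g] [AddCommGroup V] [Module K V]
    (br1 br2 : g → g → g) (ρ μ : g → V → V)
    (hc : IsCompatLie K br1 br2) (hrep : IsCompatRep K br1 br2 ρ μ) :
    (∀ v : V, (∀ x : g, ρ x v = μ x v) →
      compDelta br1 br2 ρ μ 1 (fun _ => ceD br1 ρ 0 (fun _ => v)) = 0) ∧
    (∀ n : ℕ, 1 ≤ n → ∀ ω : Fin n → (AlternatingMap K g V (Fin n)),
      compDelta br1 br2 ρ μ (n + 1)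
        (compDelta br1 br2 ρ μ n (fun i => ⇑(ω i))) = 0) := by
  obtain ⟨⟨⟨ba1, bs1, ba1', bs1'⟩, balt1, bJ1⟩, ⟨⟨ba2, bs2, ba2', bs2'⟩, balt2, bJ2⟩, bJ⟩ := hc
  obtain ⟨⟨ρl, ρa, ρs, hρ⟩, ⟨μl, μa, μs, hμ⟩, hρμ⟩ := hrep
  obtain ⟨B, rfl⟩ : ∃ B : g →ₗ[K] g →ₗ[K] g, (fun x y => B x y) = br1 :=
    ⟨LinearMap.mk₂ K br1 ba1 bs1 ba1' bs1', rfl⟩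
  obtain ⟨B', rfl⟩ : ∃ B : g →ₗ[K] g →ₗ[K] g, (fun x y => B x y) = br2 :=
    ⟨LinearMap.mk₂ K br2 ba2 bs2 ba2' bs2', rfl⟩
  obtain ⟨R, rfl⟩ : ∃ R : g →ₗ[K] V →ₗ[K] V, (fun x => ⇑(R x)) = ρ :=
    ⟨LinearMap.mk₂ K ρ ρa ρs (fun x => (ρl x).map_add) (fun c x => (ρl x).map_smul c), rfl⟩
  obtain ⟨R', rfl⟩ : ∃ R : g →ₗ[K] V →ₗ[K] V, (fun x => ⇑(R x)) = μ :=
    ⟨LinearMap.mk₂ K μ μa μs (fun x => (μl x).map_add) (fun c x => (μl x).map_smul c), rfl⟩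
  dsimp only [IsCompatPair] at *
  have hB (x y : g) : B x y = -B y x := (LinearMap.IsAlt.neg (B := B) balt1 y x).symm
  have hB' (x y : g) : B' x y = -B' y x := (LinearMap.IsAlt.neg (B := B') balt2 y x).symm
  have hJ (x y : g) : B (B x y) = B x ∘ₗ B y - B y ∘ₗ B x := by
    ext z
    have := bJ1 x y z
    rw [hB (B y z), hB (B z x), hB z x, map_neg] at this
    simp only [LinearMap.sub_apply, LinearMap.comp_apply]
    rw [← sub_eq_zero, ← this]
    abel
  have hJ' (x y : g) : B' (B' x y) = B' x ∘ₗ B' y - B' y ∘ₗ B' x := by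
    ext z
    have := bJ2 x y z
    rw [hB' (B' y z), hB' (B' z x), hB' z x, map_neg] at this
    simp only [LinearMap.sub_apply, LinearMap.comp_apply]
    rw [← sub_eq_zero, ← this]
    abel
  have hJJ (x y : g) : B (B' x y) + B' (B x y) =
      B x ∘ₗ B' y - B' y ∘ₗ B x + B' x ∘ₗ B y - B y ∘ₗ B' x := by
    ext z
    have := bJ x y z
    rw [hB' (B y z), hB' (B z x), hB z x, map_neg, hB (B' y z), hB (B' z x), hB' z x, map_neg]
      at this
    simp only [LinearMap.add_apply, LinearMap.sub_apply, LinearMap.comp_apply]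
    rw [← sub_eq_zero, ← this]
    abel
  have hR (x y : g) : R (B x y) = R x ∘ₗ R y - R y ∘ₗ R x := LinearMap.ext fun v => hρ x y v
  have hR' (x y : g) : R' (B' x y) = R' x ∘ₗ R' y - R' y ∘ₗ R' x :=
    LinearMap.ext fun v => hμ x y v
  have hRR (x y : g) : R (B' x y) + R' (B x y) =
      R x ∘ₗ R' y - R' y ∘ₗ R x + R' x ∘ₗ R y - R y ∘ₗ R' x :=
    LinearMap.ext fun v => hρμ x y v
  constructor
  · intro v hv
    set c : g [⋀^Fin 0]→ₗ[K] V := AlternatingMap.constOfIsEmpty K g (Fin 0) v with hc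
    have hc' : AlternatingMap.coboundary B R c = AlternatingMap.coboundary B' R' c := by
      ext w
      rw [AlternatingMap.coboundary_of_isEmpty, AlternatingMap.coboundary_of_isEmpty]
      exact hv _
    funext i
    rw [AlternatingMap.compDelta_apply B B' R R' hB hB' _
      (fun i => if i = 0 then AlternatingMap.coboundary B R c else 0)
      (fun i => by simp [AlternatingMap.coe_coboundary B R hB]; rfl)
      (fun i hi => if_neg (by omega))]
    fin_cases i
    · simp [AlternatingMap.coboundary_coboundary B R hB hJ hR]
      rfl
    · simp [AlternatingMap.coboundary_zero, hc',
        AlternatingMap.coboundary_coboundary B' R' hB' hJ' hR']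
      rfl
  · intro n _ ω
    funext i
    set w : ℕ → g [⋀^Fin n]→ₗ[K] V := fun i => if h : i < n then ω ⟨i, h⟩ else 0 with hw
    have hw0 (i : ℕ) (hi : n ≤ i) : w i = 0 := dif_neg (by omega)
    rw [AlternatingMap.compDelta_apply B B' R R' hB hB' _
      (fun i => AlternatingMap.coboundary B R (w i) +
        if 0 < i then AlternatingMap.coboundary B' R' (w (i - 1)) else 0)
      (AlternatingMap.compDelta_apply B B' R R' hB hB' _ w (fun i => by simp [hw]) hw0)
      (fun i hi => by
        rw [hw0 i (by omega), hw0 (i - 1) (by omega)]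
        simp [AlternatingMap.coboundary_zero])]
    refine congrArg DFunLike.coe (?_ : _ = (0 : g [⋀^Fin (n + 2)]→ₗ[K] V))
    have hanti (f : g [⋀^Fin n]→ₗ[K] V) := AlternatingMap.coboundary_anticomm
      B B' R R' hB hJ hR hB' hJ' hR' hJJ hRR f
    rcases i with ⟨_ | _ | i, hi⟩ <;>
      simp [AlternatingMap.coboundary_coboundary B R hB hJ hR, AlternatingMap.coboundary_add,
        AlternatingMap.coboundary_coboundary B' R' hB' hJ' hR', hanti]
end
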